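/- Let m be a positive integer and let f_i : I_i → ℝ (1 ≤ i ≤ 4) be smooth functions on open intervals such that f_i'(t) ≠ 0 and f_i''(t) ≠ 0 for all t in the respective interval. Then it is impossible that for all (u_1,u_2,u_3,u_4) ∈ I_1 × I_2 × I_3 × I_4: Σ_{j=1}^{4} (f_j'(u_j))^{-(2m-2)/(2m-1)} f_j''(u_j) (1 + Σ_{i≠j, 1≤i≤4} (f_i'(u_i))^{2m/(2m-1)}) = 0. -/

import Mathlib

/-- The real `(2m-1)`-th root of `y`: the unique real number `s` with `s^(2m-1) = y`.
For `y ≠ 0`, the fractional power `y^(p/(2m-1))` is interpreted as `(oddRoot m y)^p`. -/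
noncomputable def oddRoot (m : ℕ) (y : ℝ) : ℝ :=
  Real.sign y * |y| ^ ((2 * (m : ℝ) - 1)⁻¹)

/-- A separable sum `∑ j, Gⱼ(uⱼ) (1 + ∑_{i ≠ j} Hᵢ(uᵢ))` in four variables cannot vanish
identically on a product of sets if no `Gⱼ` vanishes and every `Hⱼ` is non-constant. -/
theorem not_forall_sum_mul_one_add_sum_erase_eq_zero {α : Type*} (s : Fin 4 → Set α)
    (G H : Fin 4 → α → ℝ) (hG : ∀ i, ∀ t ∈ s i, G i t ≠ 0)
    (hH : ∀ i, ∃ x ∈ s i, ∃ y ∈ s i, H i x ≠ H i y) :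
    ¬ ∀ u : Fin 4 → α, (∀ i, u i ∈ s i) →
      ∑ j, G j (u j) * (1 + ∑ i ∈ Finset.univ.erase j, H i (u i)) = 0 := by
  intro h
  choose p hp q hq hpq using hH
  simp only [Finset.sum_erase_eq_sub (Finset.mem_univ _), Fin.sum_univ_four] at h
  have update_mem : ∀ u : Fin 4 → α, (∀ i, u i ∈ s i) → ∀ k i, Function.update u k (q k) i ∈ s i := by
    intro u hu k i
    obtain rfl | hik := eq_or_ne i k
    · simpa using hq i
    · simpa [hik] using hu i
  have h_base := h p hp
  have h_single := fun i => h _ (update_mem p hp i)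
  have h_mixed : ∀ i k, i ≠ k →
      (G i (q i) - G i (p i)) * (H k (q k) - H k (p k)) +
        (G k (q k) - G k (p k)) * (H i (q i) - H i (p i)) = 0 := by
    intro i k hik
    have h_double := h _ (update_mem _ (update_mem p hp i) k)
    have h_left := h_single i
    have h_right := h_single k
    fin_cases i <;> fin_cases k <;> first
      | exact absurd rfl hik
      | (simp [Function.update] at h_double h_left h_right ⊢
         linear_combination h_double - h_left - h_right + h_base)
  have h_const : ∀ i, G i (q i) = G i (p i) := by
    intro i
    obtain ⟨j, k, hij, hik, hjk⟩ : ∃ j k : Fin 4, i ≠ j ∧ i ≠ k ∧ j ≠ k := by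
      revert i; decide
    have hj := sub_ne_zero.2 (hpq j).symm
    have hk := sub_ne_zero.2 (hpq k).symm
    have h_prod : (G i (q i) - G i (p i)) *
        ((H j (q j) - H j (p j)) * (H k (q k) - H k (p k))) = 0 := by
      linear_combination (H k (q k) - H k (p k)) / 2 * h_mixed i j hij +
        (H j (q j) - H j (p j)) / 2 * h_mixed i k hik -
        (H i (q i) - H i (p i)) / 2 * h_mixed j k hjk
    exact sub_eq_zero.1 ((mul_eq_zero.1 h_prod).resolve_right (mul_ne_zero hj hk))
  have h_sum : ∀ i, G 0 (p 0) + G 1 (p 1) + G 2 (p 2) + G 3 (p 3) - G i (p i) = 0 := by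
    intro i
    apply mul_right_cancel₀ (sub_ne_zero.2 (hpq i).symm)
    rw [zero_mul]
    have h_left := h_single i
    have h_const_i := h_const i
    fin_cases i <;>
      (simp only [Function.update, Fin.zero_eta, Fin.mk_one, Fin.reduceFinMk] at h_left h_const_i ⊢
       simp at h_left
       rw [h_const_i] at h_left
       linear_combination h_left - h_base)
  exact hG 0 _ (hp 0) (by linarith [h_sum 0, h_sum 1, h_sum 2, h_sum 3])

theorem abs_oddRoot (m : ℕ) {y : ℝ} (hy : y ≠ 0) :
    |oddRoot m y| = |y| ^ ((2 * (m : ℝ) - 1)⁻¹) := by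
  rw [oddRoot, abs_mul, abs_of_nonneg (Real.rpow_nonneg (abs_nonneg y) _)]
  rcases Real.sign_apply_eq_of_ne_zero y hy with h | h <;> simp [h]

theorem oddRoot_ne_zero (m : ℕ) {y : ℝ} (hy : y ≠ 0) : oddRoot m y ≠ 0 := by
  rw [← abs_pos, abs_oddRoot m hy]
  exact Real.rpow_pos_of_pos (abs_pos.2 hy) _

theorem sq_eq_sq_of_oddRoot_pow_eq {m : ℕ} (hm : 1 ≤ m) {x y : ℝ} (hx : x ≠ 0) (hy : y ≠ 0)
    (h : oddRoot m x ^ (2 * m) = oddRoot m y ^ (2 * m)) : x ^ 2 = y ^ 2 := by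
  have hm' : (1 : ℝ) ≤ m := by exact_mod_cast hm
  have h_abs := (pow_eq_pow_iff_of_ne_zero (by omega : 2 * m ≠ 0)).1 h
  have h_roots : |oddRoot m x| = |oddRoot m y| := by
    rcases h_abs with h' | ⟨h', -⟩ <;> simp [h']
  rw [abs_oddRoot m hx, abs_oddRoot m hy] at h_roots
  exact sq_eq_sq_iff_abs_eq_abs _ _ |>.2 <|
    (Real.rpow_left_inj (abs_nonneg x) (abs_nonneg y)
      (inv_ne_zero (by linarith : 2 * (m : ℝ) - 1 ≠ 0))).1 h_roots

/-- A function with nonvanishing value and derivative on a nonempty open interval has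
non-constant square there. -/
theorem exists_sq_ne_sq_of_deriv_ne_zero {a b : ℝ} (hab : a < b) {g : ℝ → ℝ}
    (hg : ∀ t ∈ Set.Ioo a b, g t ≠ 0) (hg' : ∀ t ∈ Set.Ioo a b, deriv g t ≠ 0) :
    ∃ x ∈ Set.Ioo a b, ∃ y ∈ Set.Ioo a b, g x ^ 2 ≠ g y ^ 2 := by
  by_contra! h
  obtain ⟨c, hc⟩ := Set.nonempty_Ioo.2 hab
  have h_deriv := (differentiableAt_of_deriv_ne_zero (hg' c hc)).hasDerivAt.pow 2
  have h_eq : (g ^ 2) =ᶠ[nhds c] fun _ => g c ^ 2 :=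
    Filter.eventually_of_mem (Ioo_mem_nhds hc.1 hc.2) fun x hx => h x hx c hc
  have h_zero := h_deriv.unique ((hasDerivAt_const c (g c ^ 2)).congr_of_eventuallyEq h_eq)
  simp [hg c hc, hg' c hc] at h_zero


/-- there is no translation minimal hypersurface
`x₅ = f₁(u₁)+⋯+f₄(u₄)` in `(ℝ⁵, ‖·‖_{2m})` with all `fᵢ'` and `fᵢ''`
nowhere vanishing. -/
theorem no_translation_minimal_n4 (m : ℕ) (hm : 1 ≤ m)
    (a b : Fin 4 → ℝ) (hab : ∀ i, a i < b i)
    (f : Fin 4 → ℝ → ℝ)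
    (hf : ∀ i, ContDiffOn ℝ (⊤ : ℕ∞) (f i) (Set.Ioo (a i) (b i)))
    (hf1 : ∀ i, ∀ t ∈ Set.Ioo (a i) (b i), deriv (f i) t ≠ 0)
    (hf2 : ∀ i, ∀ t ∈ Set.Ioo (a i) (b i), deriv (deriv (f i)) t ≠ 0) :
    ¬ (∀ u : Fin 4 → ℝ, (∀ i, u i ∈ Set.Ioo (a i) (b i)) →
        ∑ j, ((oddRoot m (deriv (f j) (u j))) ^ (2 * m - 2))⁻¹
            * deriv (deriv (f j)) (u j)
            * (1 + ∑ i ∈ Finset.univ.erase j,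
                (oddRoot m (deriv (f i) (u i))) ^ (2 * m)) = 0) := by
  refine not_forall_sum_mul_one_add_sum_erase_eq_zero (fun i => Set.Ioo (a i) (b i))
    (fun j t => ((oddRoot m (deriv (f j) t)) ^ (2 * m - 2))⁻¹ * deriv (deriv (f j)) t)
    (fun i t => (oddRoot m (deriv (f i) t)) ^ (2 * m)) ?_ ?_
  · intro i t ht
    exact mul_ne_zero (inv_ne_zero (pow_ne_zero _ (oddRoot_ne_zero m (hf1 i t ht)))) (hf2 i t ht)
  · intro i
    obtain ⟨x, hx, y, hy, hxy⟩ := exists_sq_ne_sq_of_deriv_ne_zero (hab i) (hf1 i) (hf2 i)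
    exact ⟨x, hx, y, hy,
      fun h => hxy (sq_eq_sq_of_oddRoot_pow_eq hm (hf1 i x hx) (hf1 i y hy) h)⟩
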